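/- arXiv:1307.3474 — 2 statements merged into one kernel-verified Lean document; each statement's English description precedes it below -/
import Mathlib

section
/- Let p ≥ 1 and let (A_n)_{n≥0} be a Fib_p recurrence such that every entry power series K(i,j) = ∑_{n≥0} A_n(i,j) z^n has radius of convergence at least ρ for some ρ > 1, so that f(z) = det(I_p − z·K(z)) defines a holomorphic function on the disk D_ρ = {z ∈ ℂ : |z| < ρ}. Let λ_1, …, λ_m be pairwise distinct complex numbers with |λ_i| ≥ 1 such that the set of zeros of f in the closed unit disk {|z| ≤ 1} is exactly {λ_1^{−1}, …, λ_m^{−1}}, and assume each λ_i^{−1} is a simple zero of f. Then for every solution (v_n)_{n∈ℤ} = Θ(u) of the recurrence and every α ∈ {1,…,p} there exist unique complex constants d_1^{(α)}, …, d_m^{(α)} such that v_n^{(α)} − ∑_{i=1}^m d_i^{(α)} λ_i^n → 0 as n → ∞ (an asymptotic Binet formula). -/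
open Filter

open scoped PowerSeries NNReal

/-- Power series over `ℂ` that converge absolutely on the closed disk of radius `r`. -/
def absConvSubring (r : ℝ≥0) : Subring ℂ⟦X⟧ where
  carrier := {H | Summable fun n => ‖PowerSeries.coeff n H * (r : ℂ) ^ n‖}
  mul_mem' {a b} ha hb := by
    refine (summable_norm_sum_mul_antidiagonal_of_summable_norm ha hb).congr fun n => ?_
    rw [PowerSeries.coeff_mul, Finset.sum_mul]
    congr 1
    refine Finset.sum_congr rfl fun x hx => ?_
    rw [← Finset.HasAntidiagonal.mem_antidiagonal.mp hx, pow_add]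
    ring
  one_mem' := by
    refine summable_of_ne_finset_zero (s := {0}) fun n hn => ?_
    simp [PowerSeries.coeff_one, Finset.mem_singleton.not.mp hn]
  add_mem' {a b} ha hb := by
    refine (ha.add hb).of_nonneg_of_le (fun n => norm_nonneg _) fun n => ?_
    rw [map_add, add_mul]
    exact norm_add_le _ _
  zero_mem' := by simp
  neg_mem' {a} ha := by simpa using ha

lemma mem_absConvSubring {r : ℝ≥0} {H : ℂ⟦X⟧} :
    H ∈ absConvSubring r ↔ Summable fun n => ‖PowerSeries.coeff n H‖ * (r : ℝ) ^ n := by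
  change Summable (fun n => ‖PowerSeries.coeff n H * ((r : ℝ) : ℂ) ^ n‖) ↔ _
  simp

lemma absConvSubring_anti {r s : ℝ≥0} (h : s ≤ r) : absConvSubring r ≤ absConvSubring s := by
  intro H hH
  rw [mem_absConvSubring] at hH ⊢
  refine hH.of_nonneg_of_le (fun n => by positivity) fun n => ?_
  gcongr

lemma C_mem_absConvSubring (r : ℝ≥0) (c : ℂ) : PowerSeries.C c ∈ absConvSubring r := by
  rw [mem_absConvSubring]
  refine summable_of_ne_finset_zero (s := {0}) fun n hn => ?_
  simp [PowerSeries.coeff_C, Finset.mem_singleton.not.mp hn]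

lemma X_mem_absConvSubring (r : ℝ≥0) : (PowerSeries.X : ℂ⟦X⟧) ∈ absConvSubring r := by
  rw [mem_absConvSubring]
  refine summable_of_ne_finset_zero (s := {1}) fun n hn => ?_
  simp [PowerSeries.coeff_X, Finset.mem_singleton.not.mp hn]

/-- The sum of a power series at a point. -/
noncomputable def seriesSum (H : ℂ⟦X⟧) (z : ℂ) : ℂ := ∑' n, PowerSeries.coeff n H * z ^ n

lemma summable_norm_coeff_mul_pow {r : ℝ≥0} {H : ℂ⟦X⟧} (hH : H ∈ absConvSubring r) {z : ℂ}
    (hz : ‖z‖ ≤ r) : Summable fun n => ‖PowerSeries.coeff n H * z ^ n‖ := by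
  rw [mem_absConvSubring] at hH
  refine hH.of_nonneg_of_le (fun n => norm_nonneg _) fun n => ?_
  rw [norm_mul, norm_pow]
  gcongr

@[simp] lemma seriesSum_C (c z : ℂ) : seriesSum (PowerSeries.C c) z = c := by
  rw [seriesSum, tsum_eq_single 0] <;> simp +contextual [PowerSeries.coeff_C]

@[simp] lemma seriesSum_one (z : ℂ) : seriesSum 1 z = 1 := by
  simpa using seriesSum_C 1 z

@[simp] lemma seriesSum_X (z : ℂ) : seriesSum PowerSeries.X z = z := by
  rw [seriesSum, tsum_eq_single 1] <;> simp +contextual [PowerSeries.coeff_X]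

lemma seriesSum_add {r : ℝ≥0} {G H : ℂ⟦X⟧} (hG : G ∈ absConvSubring r)
    (hH : H ∈ absConvSubring r) {z : ℂ} (hz : ‖z‖ ≤ r) :
    seriesSum (G + H) z = seriesSum G z + seriesSum H z := by
  simp only [seriesSum, map_add, add_mul]
  exact (summable_norm_coeff_mul_pow hG hz).of_norm.tsum_add
    (summable_norm_coeff_mul_pow hH hz).of_norm

lemma seriesSum_mul {r : ℝ≥0} {G H : ℂ⟦X⟧} (hG : G ∈ absConvSubring r)
    (hH : H ∈ absConvSubring r) {z : ℂ} (hz : ‖z‖ ≤ r) :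
    seriesSum (G * H) z = seriesSum G z * seriesSum H z := by
  rw [seriesSum, seriesSum, seriesSum, tsum_mul_tsum_eq_tsum_sum_antidiagonal_of_summable_norm
    (summable_norm_coeff_mul_pow hG hz) (summable_norm_coeff_mul_pow hH hz)]
  refine tsum_congr fun n => ?_
  rw [PowerSeries.coeff_mul, Finset.sum_mul]
  refine Finset.sum_congr rfl fun x hx => ?_
  rw [← Finset.HasAntidiagonal.mem_antidiagonal.mp hx, pow_add]
  ring

/-- Evaluation at a point of the closed disk of radius `r`, as a ring homomorphism. -/
noncomputable def seriesSumHom {r : ℝ≥0} {z : ℂ} (hz : ‖z‖ ≤ r) : absConvSubring r →+* ℂ where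
  toFun H := seriesSum H z
  map_one' := seriesSum_one z
  map_mul' G H := seriesSum_mul G.2 H.2 hz
  map_zero' := by simp [seriesSum]
  map_add' G H := seriesSum_add G.2 H.2 hz

lemma continuousOn_seriesSum {r : ℝ≥0} {H : ℂ⟦X⟧} (hH : H ∈ absConvSubring r) :
    ContinuousOn (seriesSum H) (Metric.closedBall 0 r) := by
  refine continuousOn_tsum (fun n => by fun_prop) (mem_absConvSubring.mp hH) fun n z hz => ?_
  rw [norm_mul, norm_pow]
  gcongr
  simpa using hz

lemma differentiableOn_seriesSum {r : ℝ≥0} {H : ℂ⟦X⟧} (hH : H ∈ absConvSubring r) :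
    DifferentiableOn ℂ (seriesSum H) (Metric.ball 0 r) := by
  refine Complex.differentiableOn_tsum_of_summable_norm (mem_absConvSubring.mp hH)
    (fun n => by fun_prop) Metric.isOpen_ball fun n z hz => ?_
  rw [norm_mul, norm_pow]
  gcongr
  simpa using (Metric.mem_ball.mp hz).le

lemma eq_of_seriesSum_eq {r : ℝ≥0} (hr : 0 < r) {G H : ℂ⟦X⟧} (hG : G ∈ absConvSubring r)
    (hH : H ∈ absConvSubring r) (h : ∀ z : ℂ, ‖z‖ ≤ r → seriesSum G z = seriesSum H z) :
    G = H := by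
  have key : ∀ F ∈ absConvSubring r, HasFPowerSeriesAt (seriesSum F)
      (FormalMultilinearSeries.ofScalars ℂ fun n => PowerSeries.coeff n F) 0 := by
    intro F hF
    rw [hasFPowerSeriesAt_iff]
    filter_upwards [Metric.closedBall_mem_nhds (0 : ℂ) (NNReal.coe_pos.mpr hr)] with z hz
    have hz' : ‖z‖ ≤ r := by simpa using hz
    simpa [FormalMultilinearSeries.coeff_ofScalars, seriesSum, mul_comm] using
      (summable_norm_coeff_mul_pow hF hz').of_norm.hasSum
  have hEq : seriesSum G =ᶠ[nhds 0] seriesSum H := by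
    filter_upwards [Metric.closedBall_mem_nhds (0 : ℂ) (NNReal.coe_pos.mpr hr)] with z hz
    exact h z (by simpa using hz)
  have := ((key G hG).congr hEq).eq_formalMultilinearSeries (key H hH)
  ext n
  simpa [FormalMultilinearSeries.coeff_ofScalars] using congrArg (fun q => q.coeff n) this

lemma exists_inv_of_seriesSum_ne_zero {r : ℝ≥0} (hr : 1 < r) {G : ℂ⟦X⟧}
    (hG : G ∈ absConvSubring r) (h : ∀ z : ℂ, ‖z‖ ≤ 1 → seriesSum G z ≠ 0) :
    ∃ s : ℝ≥0, 1 < s ∧ s ≤ r ∧ ∃ J ∈ absConvSubring s, J * G = 1 := by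
  have hcont := (differentiableOn_seriesSum hG).continuousOn
  have hopen : IsOpen (Metric.ball (0 : ℂ) r ∩ seriesSum G ⁻¹' {0}ᶜ) :=
    hcont.isOpen_inter_preimage Metric.isOpen_ball isOpen_compl_singleton
  obtain ⟨δ, hδ, hsub⟩ := (isCompact_closedBall (0 : ℂ) 1).exists_cthickening_subset_open hopen
    fun z hz => by
      have hz' : ‖z‖ ≤ 1 := by simpa using hz
      exact ⟨by simpa using hz'.trans_lt (by exact_mod_cast hr), h z hz'⟩
  rw [cthickening_closedBall hδ.le zero_le_one] at hsub
  obtain ⟨t, ht⟩ : ∃ t : ℝ≥0, (t : ℝ) = δ + 1 := ⟨⟨δ + 1, by positivity⟩, rfl⟩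
  rw [← ht] at hsub
  have ht1 : 1 < t := by
    rw [← NNReal.coe_lt_coe, ht]
    simpa using hδ
  obtain ⟨s, hs1, hst⟩ := exists_between ht1
  have hnorm : ∀ z : ℂ, ‖z‖ ≤ t → ‖z‖ < r ∧ seriesSum G z ≠ 0 := fun z hz => by
    simpa using hsub (show z ∈ Metric.closedBall 0 (t : ℝ) by simpa using hz)
  have htr : t < r := by
    simpa using (hnorm ((t : ℝ) : ℂ) (by simp)).1
  have hdiff : DifferentiableOn ℂ (fun z => (seriesSum G z)⁻¹) (Metric.closedBall 0 t) :=
    ((differentiableOn_seriesSum hG).mono fun z hz => (hsub hz).1).inv fun z hz => (hsub hz).2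
  have hps := hdiff.hasFPowerSeriesOnBall (zero_lt_one.trans ht1)
  set q := cauchyPowerSeries (fun z => (seriesSum G z)⁻¹) 0 t
  have hJ : PowerSeries.mk q.coeff ∈ absConvSubring s := by
    rw [mem_absConvSubring]
    have := q.summable_norm_mul_pow (r := s)
      ((ENNReal.coe_lt_coe.mpr hst).trans_le hps.r_le)
    simpa [FormalMultilinearSeries.norm_apply_eq_norm_coef] using this
  have hsr : s ≤ r := (hst.trans htr).le
  refine ⟨s, hs1, hsr, _, hJ, ?_⟩
  have hG' := absConvSubring_anti hsr hG
  refine eq_of_seriesSum_eq (zero_lt_one.trans hs1) (mul_mem hJ hG') (one_mem _) fun z hz => ?_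
  rw [seriesSum_mul hJ hG' hz, seriesSum_one]
  have hzt : ‖z‖ < t := hz.trans_lt (by exact_mod_cast hst)
  have hsum := hps.hasSum (y := z) (by
    simpa [← ofReal_norm, ENNReal.ofReal_lt_coe_iff] using hzt)
  have hval : seriesSum (PowerSeries.mk q.coeff) z = (seriesSum G z)⁻¹ := by
    simp only [FormalMultilinearSeries.apply_eq_pow_smul_coeff, zero_add] at hsum
    rw [← hsum.tsum_eq, seriesSum]
    simp [mul_comm]
  rw [hval, inv_mul_cancel₀ (hnorm z hzt.le).2]

lemma exists_eq_one_sub_mul {r : ℝ≥0} (hr : 1 < r) {H : ℂ⟦X⟧} (hH : H ∈ absConvSubring r)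
    {c : ℂ} (hc : 1 ≤ ‖c‖) (h0 : seriesSum H c⁻¹ = 0) :
    ∃ s : ℝ≥0, 1 < s ∧ s ≤ r ∧ ∃ Q ∈ absConvSubring s,
      H = (1 - PowerSeries.C c * PowerSeries.X) * Q := by
  have hc0 : c ≠ 0 := fun h => by simp [h] at hc; linarith
  have hcn : ‖c⁻¹‖ ≤ 1 := by rw [norm_inv]; exact inv_le_one_of_one_le₀ hc
  have hr1 : (1 : ℝ) ≤ r := by exact_mod_cast hr.le
  have hsum := mem_absConvSubring.mp hH
  have hsc := (summable_norm_coeff_mul_pow hH (hcn.trans hr1)).of_norm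
  set b : ℕ → ℂ := fun n => PowerSeries.coeff n H
  have htail : ∀ n, Summable fun k => b (n + k) * c⁻¹ ^ k := fun n => by
    have := ((summable_nat_add_iff n).mpr hsc).mul_left (c ^ n)
    refine this.congr fun k => ?_
    rw [pow_add, add_comm k n, inv_pow c n]
    field_simp
    simp only [b]
  set T : ℝ := ∑' k, ‖b k‖ * (r : ℝ) ^ k
  set Q : ℂ⟦X⟧ := PowerSeries.mk fun n => -∑' k, b (n + 1 + k) * c⁻¹ ^ (k + 1)
  have hstep : ∀ n, ∑' k, b (n + k) * c⁻¹ ^ k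
      = b n + ∑' k, b (n + 1 + k) * c⁻¹ ^ (k + 1) := fun n => by
    rw [(htail n).tsum_eq_zero_add]
    simp [add_comm, add_left_comm]
  have hbound : ∀ n, ‖PowerSeries.coeff n Q‖ * (r : ℝ) ^ n ≤ T := fun n => by
    have hs' := (summable_nat_add_iff (n + 1)).mpr hsum
    have hle : ∀ k, ‖b (n + 1 + k) * c⁻¹ ^ (k + 1)‖ * (r : ℝ) ^ n
        ≤ ‖b (k + (n + 1))‖ * (r : ℝ) ^ (k + (n + 1)) := fun k => by
      rw [norm_mul, norm_pow, add_comm (n + 1) k]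
      have h1 : ‖c⁻¹‖ ^ (k + 1) ≤ 1 := pow_le_one₀ (norm_nonneg _) hcn
      have h2 : (r : ℝ) ^ n ≤ (r : ℝ) ^ (k + (n + 1)) := pow_le_pow_right₀ hr1 (by omega)
      calc _ ≤ ‖b (k + (n + 1))‖ * 1 * (r : ℝ) ^ n := by gcongr
        _ ≤ _ := by rw [mul_one]; gcongr
    have hrn : (0 : ℝ) < (r : ℝ) ^ n := by positivity
    have hsn := hs'.of_nonneg_of_le (fun k => by positivity) hle
    have hsn' : Summable fun k => ‖b (n + 1 + k) * c⁻¹ ^ (k + 1)‖ :=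
      (summable_mul_right_iff hrn.ne').mp hsn
    calc ‖PowerSeries.coeff n Q‖ * (r : ℝ) ^ n
        ≤ (∑' k, ‖b (n + 1 + k) * c⁻¹ ^ (k + 1)‖) * (r : ℝ) ^ n := by
          gcongr
          rw [PowerSeries.coeff_mk, norm_neg]
          exact norm_tsum_le_tsum_norm hsn'
      _ = ∑' k, ‖b (n + 1 + k) * c⁻¹ ^ (k + 1)‖ * (r : ℝ) ^ n := by rw [tsum_mul_right]
      _ ≤ ∑' k, ‖b (k + (n + 1))‖ * (r : ℝ) ^ (k + (n + 1)) := hsn.tsum_le_tsum hle hs'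
      _ ≤ T := by
          have := hsum.sum_add_tsum_nat_add (n + 1)
          have hnn : 0 ≤ ∑ i ∈ Finset.range (n + 1), ‖b i‖ * (r : ℝ) ^ i :=
            Finset.sum_nonneg fun i _ => by positivity
          linarith
  obtain ⟨s, hs1, hsr⟩ := exists_between hr
  refine ⟨s, hs1, hsr.le, Q, ?_, ?_⟩
  · rw [mem_absConvSubring]
    have hgeo := (summable_geometric_of_lt_one (r := (s / r : ℝ)) (by positivity)
      ((div_lt_one (by positivity)).mpr (by exact_mod_cast hsr))).mul_left T
    refine hgeo.of_nonneg_of_le (fun n => by positivity) fun n => ?_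
    rw [div_pow, mul_div_assoc', le_div_iff₀ (by positivity), mul_right_comm]
    gcongr
    exact hbound n
  · ext n
    rw [sub_mul, one_mul, mul_assoc, map_sub, PowerSeries.coeff_C_mul]
    cases n with
    | zero =>
      have := hstep 0
      simp only [zero_add] at this
      rw [show ∑' k, b k * c⁻¹ ^ k = 0 from h0] at this
      have hb0 : b 0 = PowerSeries.constantCoeff H := by simp [b]
      simp [Q, add_comm] at this ⊢
      linear_combination -this - hb0
    | succ n =>
      have := hstep (n + 1)
      rw [PowerSeries.coeff_succ_X_mul, PowerSeries.coeff_mk, PowerSeries.coeff_mk]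
      have h2 : c * ∑' k, b (n + 1 + k) * c⁻¹ ^ (k + 1) = ∑' k, b (n + 1 + k) * c⁻¹ ^ k := by
        rw [← tsum_mul_left]
        refine tsum_congr fun k => ?_
        rw [pow_succ]
        field_simp
      linear_combination -this - h2

lemma one_sub_C_mul_X_mem (r : ℝ≥0) (c : ℂ) :
    1 - PowerSeries.C c * PowerSeries.X ∈ absConvSubring r :=
  sub_mem (one_mem _) (mul_mem (C_mem_absConvSubring r c) (X_mem_absConvSubring r))

lemma seriesSum_one_sub_C_mul_X (c z : ℂ) :
    seriesSum (1 - PowerSeries.C c * PowerSeries.X) z = 1 - c * z := by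
  rw [show (1 : ℂ⟦X⟧) - PowerSeries.C c * PowerSeries.X
    = 1 + PowerSeries.C (-c) * PowerSeries.X by rw [map_neg]; ring]
  have hz : ‖z‖ ≤ ‖z‖₊ := le_rfl
  rw [seriesSum_add (one_mem _) (mul_mem (C_mem_absConvSubring _ _) (X_mem_absConvSubring _)) hz,
    seriesSum_mul (C_mem_absConvSubring _ _) (X_mem_absConvSubring _) hz,
    seriesSum_one, seriesSum_C, seriesSum_X]
  ring

lemma seriesSum_prod_one_sub {ι : Type*} (lam : ι → ℂ) (s : Finset ι) (z : ℂ) :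
    seriesSum (∏ i ∈ s, (1 - PowerSeries.C (lam i) * PowerSeries.X)) z
      = ∏ i ∈ s, (1 - lam i * z) := by
  classical
  have hz : ‖z‖ ≤ ‖z‖₊ := le_rfl
  induction s using Finset.induction_on with
  | empty => simp
  | insert i s hi ih =>
    rw [Finset.prod_insert hi, Finset.prod_insert hi,
      seriesSum_mul (one_sub_C_mul_X_mem _ _)
        (prod_mem fun j _ => one_sub_C_mul_X_mem _ (lam j)) hz,
      seriesSum_one_sub_C_mul_X, ih]

lemma one_sub_C_mul_X_mul_mk_pow (c : ℂ) :
    (1 - PowerSeries.C c * PowerSeries.X) * PowerSeries.mk (fun n => c ^ n) = 1 := by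
  ext n
  rw [sub_mul, one_mul, mul_assoc, map_sub, PowerSeries.coeff_C_mul]
  cases n with
  | zero => simp
  | succ n =>
    rw [PowerSeries.coeff_succ_X_mul]
    simp [PowerSeries.coeff_one, pow_succ']

lemma exists_eq_prod_one_sub_mul {ι : Type*} {lam : ι → ℂ} (hinj : Function.Injective lam)
    (hdom : ∀ i, 1 ≤ ‖lam i‖) {r : ℝ≥0} (hr : 1 < r) {F : ℂ⟦X⟧} (hF : F ∈ absConvSubring r)
    (s : Finset ι) (h0 : ∀ i ∈ s, seriesSum F (lam i)⁻¹ = 0) :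
    ∃ t : ℝ≥0, 1 < t ∧ t ≤ r ∧ ∃ G ∈ absConvSubring t,
      F = (∏ i ∈ s, (1 - PowerSeries.C (lam i) * PowerSeries.X)) * G := by
  classical
  induction s using Finset.induction_on with
  | empty => exact ⟨r, hr, le_rfl, F, hF, by simp⟩
  | insert i s hi ih =>
    obtain ⟨t, ht, htr, G, hG, hFG⟩ := ih fun j hj => h0 j (Finset.mem_insert_of_mem hj)
    have hne : ∀ j, lam j ≠ 0 := fun j hj => by
      have := hdom j
      rw [hj, norm_zero] at this
      linarith
    have hn : ‖(lam i)⁻¹‖ ≤ t := by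
      rw [norm_inv]
      exact (inv_le_one_of_one_le₀ (hdom i)).trans (by exact_mod_cast ht.le)
    have hG0 : seriesSum G (lam i)⁻¹ = 0 := by
      have := h0 i (Finset.mem_insert_self i s)
      rw [hFG, seriesSum_mul (prod_mem fun j _ => one_sub_C_mul_X_mem _ (lam j)) hG hn,
        seriesSum_prod_one_sub] at this
      refine (mul_eq_zero.mp this).resolve_left (Finset.prod_ne_zero_iff.mpr fun j hj hz => ?_)
      have hij : lam j = lam i := by
        have h1 := mul_inv_cancel₀ (hne i)
        linear_combination -lam i * hz - lam j * h1
      exact hi (hinj hij ▸ hj)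
    obtain ⟨u, hu, hut, Q, hQ, hGQ⟩ := exists_eq_one_sub_mul ht hG (hdom i) hG0
    refine ⟨u, hu, hut.trans htr, Q, hQ, ?_⟩
    rw [Finset.prod_insert hi, hFG, hGQ]
    ring

lemma exists_partial_fractions {ι : Type*} {lam : ι → ℂ} (hinj : Function.Injective lam)
    (hdom : ∀ i, 1 ≤ ‖lam i‖) {r : ℝ≥0} (hr : 1 < r) {Q : ℂ⟦X⟧} (hQ : Q ∈ absConvSubring r)
    (s : Finset ι) (V : ℂ⟦X⟧)
    (hV : (∏ i ∈ s, (1 - PowerSeries.C (lam i) * PowerSeries.X)) * V = Q) :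
    ∃ t : ℝ≥0, 1 < t ∧ ∃ E ∈ absConvSubring t, ∃ d : ι → ℂ,
      V = E + ∑ i ∈ s, PowerSeries.C (d i) * PowerSeries.mk (fun n => lam i ^ n) := by
  classical
  induction s using Finset.induction_on generalizing V with
  | empty => exact ⟨r, hr, Q, hQ, 0, by simpa using hV⟩
  | insert i s hi ih =>
    rw [Finset.prod_insert hi, mul_right_comm, mul_comm] at hV
    obtain ⟨t, ht, E, hE, d, hd⟩ := ih _ hV
    set e := seriesSum E (lam i)⁻¹
    have hn : ‖(lam i)⁻¹‖ ≤ t := by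
      rw [norm_inv]
      exact (inv_le_one_of_one_le₀ (hdom i)).trans (by exact_mod_cast ht.le)
    have hE0 : seriesSum (E + PowerSeries.C (-e)) (lam i)⁻¹ = 0 := by
      rw [seriesSum_add hE (C_mem_absConvSubring _ _) hn, seriesSum_C, add_neg_cancel]
    obtain ⟨u, hu, -, R, hR, hER⟩ := exists_eq_one_sub_mul ht
      (add_mem hE (C_mem_absConvSubring t (-e))) (hdom i) hE0
    set L : ι → ℂ⟦X⟧ := fun j => 1 - PowerSeries.C (lam j) * PowerSeries.X
    set M : ι → ℂ⟦X⟧ := fun j => PowerSeries.mk fun n => lam j ^ n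
    have hLM : ∀ j, L j * M j = 1 := fun j => one_sub_C_mul_X_mul_mk_pow (lam j)
    let b : ι → ℂ := fun j => d j * (lam i / (lam i - lam j))
    let c : ι → ℂ := fun j => d j * (lam j / (lam i - lam j))
    have hsplit : ∀ j ∈ s, M i * (PowerSeries.C (d j) * M j)
        = PowerSeries.C (b j) * M i - PowerSeries.C (c j) * M j := fun j hj => by
      have hne : lam i - lam j ≠ 0 := sub_ne_zero.mpr fun h => hi (hinj h ▸ hj)
      have h1 : b j - c j = d j := by
        simp only [b, c]
        field_simp
      have h2 : b j * lam j = c j * lam i := by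
        simp only [b, c]
        ring
      have h1' := congrArg (PowerSeries.C (R := ℂ)) h1
      have h2' := congrArg (PowerSeries.C (R := ℂ)) h2
      simp only [map_sub, map_mul] at h1' h2'
      have hL : PowerSeries.C (b j) * L j - PowerSeries.C (c j) * L i = PowerSeries.C (d j) := by
        simp only [L]
        linear_combination h1' - PowerSeries.X * h2'
      linear_combination -(M i * M j) * hL + PowerSeries.C (b j) * M i * hLM j
        - PowerSeries.C (c j) * M j * hLM i
    refine ⟨u, hu, R, hR, fun j => if j = i then e + ∑ k ∈ s, b k else -c j, ?_⟩
    have hVM : V = M i * (E + ∑ j ∈ s, PowerSeries.C (d j) * M j) := by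
      rw [← hd]
      linear_combination -V * hLM i
    have hEM : M i * E = R + PowerSeries.C e * M i := by
      rw [map_neg] at hER
      linear_combination M i * hER + R * hLM i
    rw [hVM, mul_add, hEM, Finset.mul_sum, Finset.sum_congr rfl hsplit,
      Finset.sum_sub_distrib, ← Finset.sum_mul, Finset.sum_insert hi]
    beta_reduce
    rw [if_pos rfl]
    have hs : ∑ j ∈ s, PowerSeries.C (if j = i then e + ∑ k ∈ s, b k else -c j) * M j
        = -∑ j ∈ s, PowerSeries.C (c j) * M j := by
      rw [← Finset.sum_neg_distrib]
      refine Finset.sum_congr rfl fun j hj => ?_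
      rw [if_neg fun h : j = i => hi (h ▸ hj), map_neg, neg_mul]
    change _ = R + (_ * M i + ∑ j ∈ s, _ * M j)
    rw [hs, map_add, map_sum]
    ring

lemma tendsto_coeff_of_mem {r : ℝ≥0} (hr : 1 < r) {H : ℂ⟦X⟧} (hH : H ∈ absConvSubring r) :
    Tendsto (fun n => PowerSeries.coeff n H) atTop (nhds 0) := by
  refine squeeze_zero_norm (fun n => ?_) (mem_absConvSubring.mp hH).tendsto_atTop_zero
  exact le_mul_of_one_le_right (norm_nonneg _) (one_le_pow₀ (by exact_mod_cast hr.le))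

lemma exists_tendsto_coeff_sub {ι : Type*} [Fintype ι] {lam : ι → ℂ}
    (hinj : Function.Injective lam) (hdom : ∀ i, 1 ≤ ‖lam i‖) {r : ℝ≥0} (hr : 1 < r)
    {F H V : ℂ⟦X⟧} (hF : F ∈ absConvSubring r) (hH : H ∈ absConvSubring r) (hV : F * V = H)
    (hzeros : ∀ z : ℂ, ‖z‖ ≤ 1 → (seriesSum F z = 0 ↔ ∃ i, z = (lam i)⁻¹))
    (hsimple : ∀ i, ∀ t : ℝ≥0, 1 < t → t ≤ r → ∀ R ∈ absConvSubring t,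
      F ≠ (1 - PowerSeries.C (lam i) * PowerSeries.X) ^ 2 * R) :
    ∃ d : ι → ℂ, Tendsto (fun n => PowerSeries.coeff n V - ∑ i, d i * lam i ^ n)
      atTop (nhds 0) := by
  classical
  have hn : ∀ i, ‖(lam i)⁻¹‖ ≤ 1 := fun i => by
    rw [norm_inv]
    exact inv_le_one_of_one_le₀ (hdom i)
  obtain ⟨t, ht, htr, G, hG, hFG⟩ := exists_eq_prod_one_sub_mul hinj hdom hr hF Finset.univ
    fun i _ => (hzeros _ (hn i)).mpr ⟨i, rfl⟩
  have hP : ∀ (u : ℝ≥0) (s : Finset ι),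
      ∏ i ∈ s, (1 - PowerSeries.C (lam i) * PowerSeries.X) ∈ absConvSubring u :=
    fun u s => prod_mem fun j _ => one_sub_C_mul_X_mem _ (lam j)
  have hGne : ∀ z : ℂ, ‖z‖ ≤ 1 → seriesSum G z ≠ 0 := fun z hz hG0 => by
    have hFz : seriesSum F z = 0 := by
      rw [hFG, seriesSum_mul (hP t _) hG (hz.trans (by exact_mod_cast ht.le)), hG0, mul_zero]
    obtain ⟨i, rfl⟩ := (hzeros z hz).mp hFz
    obtain ⟨u, hu, hut, Q, hQ, hGQ⟩ := exists_eq_one_sub_mul ht hG (hdom i) hG0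
    refine hsimple i u hu (hut.trans htr) _ (mul_mem (hP u (Finset.univ.erase i)) hQ) ?_
    rw [hFG, hGQ, ← Finset.mul_prod_erase _ _ (Finset.mem_univ i)]
    ring
  obtain ⟨u, hu, hut, J, hJ, hJG⟩ := exists_inv_of_seriesSum_ne_zero ht hG hGne
  obtain ⟨w, hw, E, hE, d, hd⟩ := exists_partial_fractions hinj hdom hu
    (mul_mem hJ (absConvSubring_anti (hut.trans htr) hH)) Finset.univ V (by
      rw [← hV]
      linear_combination
        -(∏ i, (1 - PowerSeries.C (lam i) * PowerSeries.X)) * V * hJG - J * V * hFG)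
  refine ⟨d, (tendsto_coeff_of_mem hw hE).congr fun n => ?_⟩
  rw [hd]
  simp

lemma eq_zero_of_tendsto_sum_mul_pow {ι : Type*} {lam : ι → ℂ} (hinj : Function.Injective lam)
    (hdom : ∀ i, 1 ≤ ‖lam i‖) (s : Finset ι) (e : ι → ℂ)
    (h : Tendsto (fun n : ℕ => ∑ i ∈ s, e i * lam i ^ n) atTop (nhds 0)) :
    ∀ i ∈ s, e i = 0 := by
  classical
  induction s using Finset.induction_on generalizing e with
  | empty => simp
  | insert i s hi ih =>
    have hs : ∀ j ∈ s, e j = 0 := by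
      have h' := ((tendsto_add_atTop_iff_nat 1).mpr h).sub (h.const_mul (lam i))
      rw [mul_zero, sub_zero] at h'
      have := ih (fun j => e j * (lam j - lam i)) (h'.congr fun n => by
        rw [Finset.sum_insert hi, Finset.sum_insert hi, mul_add, Finset.mul_sum,
          add_sub_add_comm, ← Finset.sum_sub_distrib]
        rw [show e i * lam i ^ (n + 1) - lam i * (e i * lam i ^ n) = 0 by ring, zero_add]
        exact Finset.sum_congr rfl fun j _ => by ring)
      exact fun j hj => (mul_eq_zero.mp (this j hj)).resolve_right
        (sub_ne_zero.mpr fun hji => hi (hinj hji ▸ hj))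
    have hei : e i = 0 := by
      have h' : Tendsto (fun n : ℕ => e i * lam i ^ n) atTop (nhds 0) := h.congr fun n => by
        rw [Finset.sum_insert hi, Finset.sum_eq_zero fun j hj => by rw [hs j hj, zero_mul],
          add_zero]
      have hle : ‖e i‖ ≤ 0 := ge_of_tendsto' (by simpa using h'.norm) fun n => by
        exact le_mul_of_one_le_right (norm_nonneg _) (one_le_pow₀ (hdom i))
      simpa using hle
    intro j hj
    rcases Finset.mem_insert.mp hj with rfl | hj
    exacts [hei, hs j hj]

lemma false_of_simple_zero_of_sq {r : ℝ≥0} (hr : 1 < r) {R : ℂ⟦X⟧}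
    (hR : R ∈ absConvSubring r) {f g : ℂ → ℂ} {c : ℂ} (hc : 1 ≤ ‖c‖)
    (hf : ∀ z : ℂ, ‖z‖ ≤ r →
      f z = seriesSum ((1 - PowerSeries.C c * PowerSeries.X) ^ 2 * R) z)
    (hg : ContinuousAt g c⁻¹) (hg0 : g c⁻¹ ≠ 0)
    (hfg : ∀ᶠ z in nhds c⁻¹, f z = (z - c⁻¹) * g z) : False := by
  have hc0 : c ≠ 0 := fun h => by
    rw [h, norm_zero] at hc
    linarith
  have hmem : c⁻¹ ∈ Metric.ball (0 : ℂ) r := by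
    rw [mem_ball_zero_iff, norm_inv]
    exact (inv_le_one_of_one_le₀ hc).trans_lt (by exact_mod_cast hr)
  have hball := Metric.isOpen_ball.mem_nhds hmem
  have hRc : ContinuousAt (seriesSum R) c⁻¹ :=
    (differentiableOn_seriesSum hR).continuousOn.continuousAt hball
  have hev : ∀ᶠ z in nhdsWithin c⁻¹ {c⁻¹}ᶜ, c ^ 2 * (z - c⁻¹) * seriesSum R z = g z := by
    filter_upwards [nhdsWithin_le_nhds hfg, nhdsWithin_le_nhds hball, self_mem_nhdsWithin]
      with z hz hzr hne
    have hz' : ‖z‖ ≤ r := (mem_ball_zero_iff.mp hzr).le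
    have hL := one_sub_C_mul_X_mem r c
    rw [hf z hz', seriesSum_mul (pow_mem hL 2) hR hz', pow_two, seriesSum_mul hL hL hz',
      seriesSum_one_sub_C_mul_X] at hz
    refine mul_left_cancel₀ (sub_ne_zero.mpr hne) ?_
    rw [← hz]
    field_simp
    ring
  have h1 : Tendsto (fun z => c ^ 2 * (z - c⁻¹) * seriesSum R z) (nhds c⁻¹)
      (nhds (c ^ 2 * (c⁻¹ - c⁻¹) * seriesSum R c⁻¹)) :=
    ContinuousAt.mul (by fun_prop) hRc
  refine hg0 (tendsto_nhds_unique (hg.tendsto.mono_left nhdsWithin_le_nhds)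
    (((h1.mono_left nhdsWithin_le_nhds).congr' hev).trans (by simp)))

/-- The generating series `V` of a solution, multiplied by `1 - X * K`, has only the contribution
of the initial condition left, which converges wherever `K` does. -/
lemma sub_X_mul_sum_mem_absConvSubring {p : ℕ} {A : ℕ → Matrix (Fin p) (Fin p) ℂ} {r : ℝ≥0}
    (hr : 1 < r)
    (hK : ∀ i j, PowerSeries.mk (fun n => A n i j) ∈ absConvSubring r)
    {v : ℤ → Fin p → ℂ} (hsupp : {n : ℤ | n < 0 ∧ v n ≠ 0}.Finite)
    (hrec : ∀ n : ℕ, v ((n : ℤ) + 1) = ∑' i : ℕ, (A i).mulVec (v ((n : ℤ) - (i : ℤ))))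
    (a : Fin p) :
    PowerSeries.mk (fun n => v n a) - PowerSeries.X *
      ∑ j, PowerSeries.mk (fun n => A n a j) * PowerSeries.mk (fun n => v n j)
        ∈ absConvSubring r := by
  obtain ⟨N, hN⟩ : ∃ N : ℕ, ∀ n : ℤ, n < -N → v n = 0 := by
    obtain ⟨b, hb⟩ := hsupp.bddBelow
    refine ⟨b.natAbs, fun n hn => ?_⟩
    by_contra hne
    have := hb ⟨by omega, hne⟩
    omega
  set B : ℂ⟦X⟧ := PowerSeries.mk (fun n => v n a) - PowerSeries.X *
      ∑ j, PowerSeries.mk (fun n => A n a j) * PowerSeries.mk (fun n => v n j)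
  have hcoeff : ∀ n : ℕ, PowerSeries.coeff (n + 1) B
      = ∑ k ∈ Finset.range N, ∑ j, A (n + 1 + k) a j * v (-1 - (k : ℤ)) j := fun n => by
    have h1 : v ((n : ℤ) + 1) = ∑ i ∈ Finset.range (n + 1 + N),
        (A i).mulVec (v ((n : ℤ) - (i : ℤ))) := by
      rw [hrec n]
      refine tsum_eq_sum fun i hi => ?_
      rw [hN _ (by rw [Finset.mem_range] at hi; omega), Matrix.mulVec_zero]
    have h2 := congrFun h1 a
    rw [Finset.sum_apply, Finset.sum_range_add] at h2
    simp only [Matrix.mulVec, dotProduct] at h2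
    rw [map_sub, PowerSeries.coeff_succ_X_mul]
    simp only [PowerSeries.coeff_mk, map_sum, PowerSeries.coeff_mul,
      Finset.Nat.sum_antidiagonal_eq_sum_range_succ_mk]
    push_cast
    rw [h2, Finset.sum_comm, add_sub_assoc, add_comm, sub_add_eq_add_sub, sub_eq_iff_eq_add]
    congr 1
    · refine Finset.sum_congr rfl fun k _ => Finset.sum_congr rfl fun j _ => ?_
      congr 2
      push_cast
      ring
    · refine Finset.sum_congr rfl fun j _ => Finset.sum_congr rfl fun i hi => ?_
      rw [Nat.cast_sub (Nat.lt_succ_iff.mp (Finset.mem_range.mp hi))]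
  rw [mem_absConvSubring, ← summable_nat_add_iff 1]
  have hbound : Summable fun n : ℕ => ∑ k ∈ Finset.range N, ∑ j,
      ‖A (n + (1 + k)) a j‖ * (r : ℝ) ^ (n + (1 + k)) * ‖v (-1 - (k : ℤ)) j‖ := by
    refine summable_sum fun k _ => summable_sum fun j _ => Summable.mul_right _ ?_
    have h := mem_absConvSubring.mp (hK a j)
    simp only [PowerSeries.coeff_mk] at h
    exact (summable_nat_add_iff (f := fun n => ‖A n a j‖ * (r : ℝ) ^ n) (1 + k)).mpr h
  refine hbound.of_nonneg_of_le (fun n => by positivity) fun n => ?_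
  rw [hcoeff]
  have hr1 : (1 : ℝ) ≤ r := by exact_mod_cast hr.le
  calc _ ≤ (∑ k ∈ Finset.range N, ∑ j, ‖A (n + 1 + k) a j * v (-1 - (k : ℤ)) j‖)
        * (r : ℝ) ^ (n + 1) := by
        gcongr
        exact (norm_sum_le _ _).trans (Finset.sum_le_sum fun k _ => norm_sum_le _ _)
    _ ≤ _ := by
        rw [Finset.sum_mul]
        refine Finset.sum_le_sum fun k _ => ?_
        rw [Finset.sum_mul]
        refine Finset.sum_le_sum fun j _ => ?_
        rw [norm_mul, mul_right_comm, add_assoc n 1 k]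
        have : (r : ℝ) ^ (n + 1) ≤ (r : ℝ) ^ (n + (1 + k)) := pow_le_pow_right₀ hr1 (by omega)
        gcongr

/-- **Asymptotic Binet formula (simple dominant eigenvalues).**
Let `(A_n)` be a `Fib_p` recurrence whose entry power series `K(i,j) = ∑ A_n(i,j) z^n`
all have radius of convergence at least `ρ` for some `ρ > 1`, and let
`f(z) = det(I_p − z K(z))` be the holomorphic function on `D_ρ` defined by the kneading
determinant.  Suppose `λ_1, …, λ_m` are pairwise distinct with `|λ_i| ≥ 1`, the zero set
of `f` in the closed unit disk is exactly `{λ_1⁻¹, …, λ_m⁻¹}`, and each `λ_i⁻¹` is a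
simple zero of `f`.  Then for every solution `(v_n)_{n∈ℤ}` of the recurrence (with
`v_n = 0` for all but finitely many `n < 0` and `v_{n+1} = ∑_{i=0}^∞ A_i v_{n−i}` for
`n ≥ 0`, the sum having finitely many nonzero terms) and every component `α`, there are
unique constants `d_1, …, d_m` with `v_n^{(α)} − ∑_i d_i λ_i^n → 0` as `n → ∞`. -/
theorem stmt4 (p : ℕ) (hp : 0 < p) (A : ℕ → Matrix (Fin p) (Fin p) ℂ)
    (ρ : ℝ) (hρ : 1 < ρ)
    (hconv : ∀ (i j : Fin p) (z : ℂ), ‖z‖ < ρ → Summable fun n : ℕ => A n i j * z ^ n)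
    (f : ℂ → ℂ)
    (hf : ∀ z : ℂ, f z =
      Matrix.det (1 - z • Matrix.of fun i j : Fin p => ∑' n : ℕ, A n i j * z ^ n))
    (m : ℕ) (lam : Fin m → ℂ) (hinj : Function.Injective lam)
    (hdom : ∀ i, 1 ≤ ‖lam i‖)
    (hzeros : ∀ z : ℂ, ‖z‖ ≤ 1 → (f z = 0 ↔ ∃ i, z = (lam i)⁻¹))
    (hsimple : ∀ i, ∃ g : ℂ → ℂ, AnalyticAt ℂ g (lam i)⁻¹ ∧ g (lam i)⁻¹ ≠ 0 ∧
      ∀ᶠ z in nhds (lam i)⁻¹, f z = (z - (lam i)⁻¹) * g z)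
    (v : ℤ → Fin p → ℂ)
    (hsupp : {n : ℤ | n < 0 ∧ v n ≠ 0}.Finite)
    (hrec : ∀ n : ℕ, v ((n : ℤ) + 1) = ∑' i : ℕ, (A i).mulVec (v ((n : ℤ) - (i : ℤ))))
    (a : Fin p) :
    ∃! d : Fin m → ℂ,
      Tendsto (fun n : ℕ => v (n : ℤ) a - ∑ i : Fin m, d i * lam i ^ n)
        atTop (nhds 0) := by
  obtain ⟨r', hr1', hrρ⟩ := exists_between hρ
  obtain ⟨r, rfl⟩ : ∃ r : ℝ≥0, (r : ℝ) = r' := ⟨⟨r', by linarith⟩, rfl⟩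
  have hr : 1 < r := by exact_mod_cast hr1'
  have hK : ∀ i j, PowerSeries.mk (fun n => A n i j) ∈ absConvSubring r := fun i j => by
    rw [mem_absConvSubring]
    simpa using (hconv i j ((r : ℝ) : ℂ) (by simpa using hrρ)).norm
  let K : Matrix (Fin p) (Fin p) (absConvSubring r) :=
    Matrix.of fun i j => ⟨PowerSeries.mk fun n => A n i j, hK i j⟩
  let M : Matrix (Fin p) (Fin p) (absConvSubring r) :=
    1 - (⟨PowerSeries.X, X_mem_absConvSubring r⟩ : absConvSubring r) • K
  have hfM : ∀ z : ℂ, ‖z‖ ≤ r → f z = seriesSum (M.det : ℂ⟦X⟧) z := fun z hz => by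
    change f z = seriesSumHom hz M.det
    rw [hf, RingHom.map_det, map_sub, map_one]
    congr 2
    ext i j
    have hX : seriesSumHom hz ⟨PowerSeries.X, X_mem_absConvSubring r⟩ = z := seriesSum_X z
    have hKz : seriesSumHom hz (K i j) = ∑' n : ℕ, A n i j * z ^ n := by
      change seriesSum _ z = _
      simp [seriesSum, K]
    simp [hX, hKz]
  let V : Fin p → ℂ⟦X⟧ := fun i => PowerSeries.mk fun n => v n i
  let B : Fin p → absConvSubring r := fun i =>
    ⟨_, sub_X_mul_sum_mem_absConvSubring hr hK hsupp hrec i⟩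
  let φ := (absConvSubring r).subtype
  have hMV : (φ.mapMatrix M).mulVec V = φ ∘ B := by
    rw [map_sub, map_one, Matrix.sub_mulVec, Matrix.one_mulVec]
    ext1 i
    simp only [Pi.sub_apply, Function.comp_apply]
    change V i - _ = V i - PowerSeries.X * _
    congr 1
    simp only [Matrix.mulVec, dotProduct, Finset.mul_sum]
    exact Finset.sum_congr rfl fun j _ => mul_assoc _ _ _
  have hFV : (M.det : ℂ⟦X⟧) * V a = ((M.adjugate.mulVec B a : absConvSubring r) : ℂ⟦X⟧) := by
    have h1 : (φ.mapMatrix M).adjugate.mulVec (φ ∘ B) = (φ.mapMatrix M).det • V := by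
      rw [← hMV, Matrix.mulVec_mulVec, Matrix.adjugate_mul, Matrix.smul_mulVec,
        Matrix.one_mulVec]
    have h2 := congrFun h1 a
    rw [← RingHom.map_adjugate, ← RingHom.map_det] at h2
    exact h2.symm.trans (RingHom.map_mulVec φ M.adjugate B a).symm
  obtain ⟨d, hd⟩ := exists_tendsto_coeff_sub hinj hdom hr M.det.2 (M.adjugate.mulVec B a).2 hFV
    (fun z hz => by rw [← hfM z (hz.trans hr1'.le)]; exact hzeros z hz)
    (fun i t ht htr R hR hFR => by
      obtain ⟨g, hg, hg0, hfg⟩ := hsimple i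
      refine false_of_simple_zero_of_sq ht hR (hdom i) (fun z hz => ?_) hg.continuousAt hg0 hfg
      rw [← hFR]
      exact hfM z (hz.trans (by exact_mod_cast htr)))
  simp only [V, PowerSeries.coeff_mk] at hd
  refine ⟨d, hd, fun d' hd' => funext fun i => ?_⟩
  refine sub_eq_zero.mp (eq_zero_of_tendsto_sum_mul_pow hinj hdom Finset.univ
    (fun i => d' i - d i) ?_ i (Finset.mem_univ i))
  have h := hd.sub hd'
  rw [sub_zero] at h
  refine h.congr fun n => ?_
  simp only [sub_mul, Finset.sum_sub_distrib]
  ring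
end

section
/- Consider the Fib_2 recurrence (p = 2) defined by the matrices A_n = (1/n!)·[[−1/(n+1), 2^n], [(−1)^n, 0]] for n ∈ ℕ. Then every solution (v_n)_{n∈ℤ} of this recurrence is asymptotically periodic with period 2: for α = 1, 2 there exist unique complex constants c_1^{(α)}, c_2^{(α)} such that v_n^{(α)} − c_1^{(α)} − c_2^{(α)}·(−1)^n → 0 as n → ∞; consequently both subsequences (v_{2n})_{n≥0} and (v_{2n+1})_{n≥0} converge in ℂ², with limits (c_1^{(1)} + c_2^{(1)}, c_1^{(2)} + c_2^{(2)}) and (c_1^{(1)} − c_2^{(1)}, c_1^{(2)} − c_2^{(2)}) respectively. -/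
open Filter

/-- The matrices of the example `Fib_2` recurrence:
`A_n = (1/n!)·[[−1/(n+1), 2^n], [(−1)^n, 0]]`. -/
noncomputable def exA (n : ℕ) : Matrix (Fin 2) (Fin 2) ℂ :=
  ((n.factorial : ℂ))⁻¹ • !![-1 / ((n : ℂ) + 1), 2 ^ n; (-1 : ℂ) ^ n, 0]

open PowerSeries in
/-- A power series whose coefficients are absolutely summable. -/
def SummableCoeff (F : PowerSeries ℂ) : Prop :=
  Summable fun n => ‖coeff n F‖

namespace SummableCoeff

open PowerSeries

variable {F G : PowerSeries ℂ}

theorem add (hF : SummableCoeff F) (hG : SummableCoeff G) : SummableCoeff (F + G) := by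
  refine Summable.of_nonneg_of_le (fun _ => norm_nonneg _) (fun n => ?_) (Summable.add hF hG)
  rw [map_add]
  exact norm_add_le _ _

theorem mul (hF : SummableCoeff F) (hG : SummableCoeff G) : SummableCoeff (F * G) := by
  simpa only [SummableCoeff, coeff_mul] using
    summable_norm_sum_mul_antidiagonal_of_summable_norm hF hG

theorem of_eventually_zero (N : ℕ) (h : ∀ n, N ≤ n → coeff n F = 0) : SummableCoeff F := by
  refine summable_of_ne_finset_zero (s := Finset.range N) fun n hn => ?_
  rw [h n (by simpa using hn), norm_zero]

theorem X_pow (k : ℕ) : SummableCoeff (X ^ k) :=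
  of_eventually_zero (k + 1) fun n hn => by rw [coeff_X_pow, if_neg (by omega)]

theorem X : SummableCoeff X := by
  simpa using X_pow 1

theorem one_sub_X_sq : SummableCoeff (1 - PowerSeries.X ^ 2) :=
  of_eventually_zero 3 fun n hn => by
    rw [map_sub, coeff_X_pow, coeff_one, if_neg (by omega), if_neg (by omega), sub_zero]

theorem rescale_exp (c : ℂ) : SummableCoeff (rescale c (exp ℂ)) := by
  refine (Real.summable_pow_div_factorial ‖c‖).congr fun n => ?_
  simp [coeff_rescale, coeff_exp, div_eq_mul_inv]

end SummableCoeff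

section EvenOdd

variable {α : Type*} {l : Filter α} {f : ℕ → α}

theorem tendsto_of_tendsto_even_odd (h₀ : Tendsto (fun n => f (2 * n)) atTop l)
    (h₁ : Tendsto (fun n => f (2 * n + 1)) atTop l) : Tendsto f atTop l := by
  intro s hs
  obtain ⟨a, ha⟩ := mem_atTop_sets.1 (h₀ hs)
  obtain ⟨b, hb⟩ := mem_atTop_sets.1 (h₁ hs)
  refine mem_atTop_sets.2 ⟨2 * a + 2 * b + 1, fun n hn => ?_⟩
  rcases Nat.even_or_odd' n with ⟨k, rfl | rfl⟩
  · exact ha k (by omega)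
  · exact hb k (by omega)

end EvenOdd

theorem tendsto_two_mul_add_atTop (k : ℕ) : Tendsto (fun n : ℕ => 2 * n + k) atTop atTop :=
  tendsto_atTop_mono (fun n => by rw [id]; omega) tendsto_id

/-- A sequence differs from `c + d * (-1) ^ n` by a null sequence exactly when its even and odd
subsequences converge to `c + d` and `c - d`. -/
theorem tendsto_sub_alternating_iff (f : ℕ → ℂ) (c d : ℂ) :
    Tendsto (fun n => f n - c - d * (-1) ^ n) atTop (nhds 0) ↔
      Tendsto (fun n => f (2 * n)) atTop (nhds (c + d)) ∧
        Tendsto (fun n => f (2 * n + 1)) atTop (nhds (c - d)) := by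
  constructor
  · intro h
    constructor
    · have := (h.comp (tendsto_two_mul_add_atTop 0)).add_const (c + d)
      rw [zero_add] at this
      refine this.congr fun n => ?_
      simp [pow_mul]
    · have := (h.comp (tendsto_two_mul_add_atTop 1)).add_const (c - d)
      rw [zero_add] at this
      refine this.congr fun n => ?_
      simp [pow_mul, pow_succ]
  · rintro ⟨h₀, h₁⟩
    apply tendsto_of_tendsto_even_odd
    · have := h₀.sub_const (c + d)
      rw [sub_self] at this
      refine this.congr fun n => ?_
      simp [pow_mul, sub_sub]
    · have := h₁.sub_const (c - d)
      rw [sub_self] at this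
      refine this.congr fun n => ?_
      simp only [pow_mul, pow_succ, pow_zero]
      norm_num
      ring

/-- If the second differences `f (n + 2) - f n` are summable, then the subsequences of `f` along
each residue class modulo `2` converge. -/
theorem exists_tendsto_two_mul_add {f : ℕ → ℂ} (h : Summable fun n => ‖f (n + 2) - f n‖)
    (k : ℕ) : ∃ L, Tendsto (fun n => f (2 * n + k)) atTop (nhds L) := by
  refine cauchySeq_tendsto_of_complete (cauchySeq_of_summable_dist ?_)
  refine (h.comp_injective (i := fun n => 2 * n + k) fun a b hab => by
    simp only at hab; omega).congr fun n => ?_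
  rw [dist_comm, dist_eq_norm]
  simp only [Function.comp_apply]
  congr 3
  omega

theorem exists_tendsto_sub_alternating {f : ℕ → ℂ} (h : Summable fun n => ‖f (n + 2) - f n‖) :
    ∃ c : ℂ × ℂ, Tendsto (fun n => f n - c.1 - c.2 * (-1) ^ n) atTop (nhds 0) := by
  obtain ⟨L₀, h₀⟩ := exists_tendsto_two_mul_add h 0
  obtain ⟨L₁, h₁⟩ := exists_tendsto_two_mul_add h 1
  refine ⟨((L₀ + L₁) / 2, (L₀ - L₁) / 2), (tendsto_sub_alternating_iff _ _ _).2 ⟨?_, ?_⟩⟩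
  · convert! h₀ using 2
    ring
  · convert! h₁ using 2
    ring

open PowerSeries in
theorem SummableCoeff.summable_sub {F : PowerSeries ℂ}
    (h : SummableCoeff ((1 - PowerSeries.X ^ 2) * F)) :
    Summable fun n => ‖coeff (n + 2) F - coeff n F‖ := by
  refine ((summable_nat_add_iff 2).2 h).congr fun n => ?_
  rw [sub_mul, one_mul, map_sub, coeff_X_pow_mul]

section GeneratingFunction

open PowerSeries

variable {ι : Type*} [Fintype ι]

/-- The generating functions of a solution of a matrix recurrence with absolutely summable
coefficients satisfy `V = z A(z) V + G`, where `G` comes from the negative part of the solution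
and has absolutely summable coefficients. -/
theorem exists_generatingFunction_eq (A : ℕ → Matrix ι ι ℂ)
    (hA : ∀ a b, SummableCoeff (mk fun n => A n a b)) (v : ℤ → ι → ℂ)
    (hsupp : {n : ℤ | n < 0 ∧ v n ≠ 0}.Finite)
    (hrec : ∀ n : ℕ, v ((n : ℤ) + 1) = ∑' i : ℕ, (A i).mulVec (v ((n : ℤ) - (i : ℤ)))) :
    ∃ G : ι → PowerSeries ℂ, (∀ a, SummableCoeff (G a)) ∧
      ∀ a, (mk fun n : ℕ => v n a) =
        PowerSeries.X * ∑ b, (mk fun n => A n a b) * (mk fun n : ℕ => v n b) + G a := by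
  obtain ⟨K, hK⟩ : ∃ K : ℕ, ∀ n : ℤ, n < -K → v n = 0 := by
    obtain ⟨m, hm⟩ := hsupp.bddBelow
    refine ⟨m.natAbs, fun n hn => ?_⟩
    by_contra hv
    have := hm ⟨by omega, hv⟩
    omega
  set g : ι → ℕ → ℂ := fun a n => ∑ k ∈ Finset.range K, ∑ b, A (n + k) a b * v (-1 - k) b
  refine ⟨fun a => mk fun n => if n = 0 then v 0 a else g a n, fun a => ?_, fun a => ?_⟩
  · have hs : Summable fun n => ‖g a n‖ := by
      refine Summable.of_nonneg_of_le (fun _ => norm_nonneg _)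
        (fun n => norm_sum_le_of_le _ fun k _ => norm_sum_le _ _) ?_
      refine summable_sum fun k _ => summable_sum fun b _ => ?_
      simp only [norm_mul]
      refine Summable.mul_right _ ?_
      exact (summable_nat_add_iff k).2 (by simpa [SummableCoeff] using hA a b)
    refine (summable_nat_add_iff 1).1 (((summable_nat_add_iff 1).2 hs).congr fun n => ?_)
    simp
  · ext n
    rcases n with _ | n
    · simp
    · have hsum : v ((n : ℤ) + 1) =
          ∑ i ∈ Finset.range (n + 1 + K), (A i).mulVec (v ((n : ℤ) - i)) := by
        rw [hrec n]
        refine tsum_eq_sum fun i hi => ?_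
        rw [Finset.mem_range] at hi
        rw [hK _ (by omega), Matrix.mulVec_zero]
      rw [Finset.sum_range_add] at hsum
      have := congrFun hsum a
      rw [map_add, coeff_succ_X_mul, map_sum]
      simp only [coeff_mk, coeff_mul, Finset.Nat.sum_antidiagonal_eq_sum_range_succ_mk,
        if_neg n.succ_ne_zero]
      rw [Nat.cast_succ, this, Pi.add_apply, Finset.sum_apply, Finset.sum_apply]
      congr 1
      · rw [Finset.sum_comm]
        refine Finset.sum_congr rfl fun i hi => ?_
        rw [Finset.mem_range] at hi
        simp only [Matrix.mulVec, dotProduct]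
        rw [Nat.cast_sub (by omega)]
      · refine Finset.sum_congr rfl fun k _ => ?_
        simp only [Matrix.mulVec, dotProduct]
        have : (n : ℤ) - ((n + 1 + k : ℕ) : ℤ) = -1 - k := by push_cast; ring
        rw [this]

end GeneratingFunction

section Example

open PowerSeries

theorem mk_exA_zero_one : (mk fun n => exA n 0 1) = rescale 2 (exp ℂ) := by
  ext n
  simp [exA, coeff_exp, mul_comm]

theorem mk_exA_one_zero : (mk fun n => exA n 1 0) = rescale (-1) (exp ℂ) := by
  ext n
  simp [exA, coeff_exp, mul_comm]

theorem mk_exA_one_one : (mk fun n => exA n 1 1) = 0 := by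
  ext n
  simp [exA]

theorem X_mul_mk_exA_zero_zero :
    PowerSeries.X * (mk fun n => exA n 0 0) = 1 - rescale 1 (exp ℂ) := by
  ext n
  rcases n with _ | n
  · simp
  · simp [exA, coeff_succ_X_mul, coeff_exp, coeff_one, Nat.factorial_succ, div_eq_mul_inv,
      mul_comm]

theorem summableCoeff_exA (a b : Fin 2) : SummableCoeff (mk fun n => exA n a b) := by
  fin_cases a <;> fin_cases b
  · refine Summable.of_nonneg_of_le (fun _ => norm_nonneg _) (fun n => ?_)
      (SummableCoeff.rescale_exp 1)
    have : ‖((n : ℂ) + 1)⁻¹‖ ≤ 1 := by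
      rw [norm_inv]
      apply inv_le_one_of_one_le₀
      norm_cast
      simp
    simpa [exA, coeff_exp, div_eq_mul_inv] using
      mul_le_of_le_one_right (by positivity : 0 ≤ ((n.factorial : ℝ))⁻¹) (by simpa using this)
  · exact mk_exA_zero_one ▸ SummableCoeff.rescale_exp 2
  · exact mk_exA_one_zero ▸ SummableCoeff.rescale_exp (-1)
  · exact SummableCoeff.of_eventually_zero 0 fun n _ => by simp [exA]

/-- The generating functions of a solution become series with absolutely summable coefficients
after multiplication by `1 - z²`. -/
theorem summableCoeff_one_sub_X_sq_mul (v : ℤ → Fin 2 → ℂ)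
    (hsupp : {n : ℤ | n < 0 ∧ v n ≠ 0}.Finite)
    (hrec : ∀ n : ℕ, v ((n : ℤ) + 1) = ∑' i : ℕ, (exA i).mulVec (v ((n : ℤ) - (i : ℤ))))
    (a : Fin 2) :
    SummableCoeff ((1 - PowerSeries.X ^ 2) * mk fun n : ℕ => v n a) := by
  obtain ⟨G, hG, hV⟩ := exists_generatingFunction_eq exA summableCoeff_exA v hsupp hrec
  have h₀ := hV 0
  have h₁ := hV 1
  simp only [Fin.sum_univ_two, mk_exA_zero_one, mk_exA_one_zero, mk_exA_one_one, mul_add,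
    ← mul_assoc, X_mul_mk_exA_zero_zero] at h₀ h₁
  have hE : rescale (1 : ℂ) (exp ℂ) * rescale (-1) (exp ℂ) = 1 := by
    rw [exp_mul_exp_eq_exp_add]; simp
  have hE₂ : rescale (2 : ℂ) (exp ℂ) * rescale (-1) (exp ℂ) = rescale 1 (exp ℂ) := by
    rw [exp_mul_exp_eq_exp_add]; norm_num
  have s₁ := SummableCoeff.rescale_exp (-1)
  have s₂ := SummableCoeff.rescale_exp 2
  generalize rescale (1 : ℂ) (exp ℂ) = E at *
  generalize rescale (-1 : ℂ) (exp ℂ) = M at *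
  generalize rescale (2 : ℂ) (exp ℂ) = D at *
  have key₀ : (1 - PowerSeries.X ^ 2) * (mk fun n : ℕ => v n 0) =
      M * (PowerSeries.X * D * G 1 + G 0) := by
    generalize (mk fun n : ℕ => v n 0) = V₀ at *
    generalize (mk fun n : ℕ => v n 1) = V₁ at *
    linear_combination M * h₀ + M * PowerSeries.X * D * h₁ -
      (1 - PowerSeries.X ^ 2) * V₀ * hE + M * PowerSeries.X ^ 2 * V₀ * hE₂
  have s₀ : SummableCoeff ((1 - PowerSeries.X ^ 2) * (mk fun n : ℕ => v n 0)) :=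
    key₀ ▸ s₁.mul (((SummableCoeff.X.mul s₂).mul (hG 1)).add (hG 0))
  have key₁ : (1 - PowerSeries.X ^ 2) * (mk fun n : ℕ => v n 1) =
      PowerSeries.X * M * ((1 - PowerSeries.X ^ 2) * (mk fun n : ℕ => v n 0)) +
        (1 - PowerSeries.X ^ 2) * G 1 := by
    linear_combination (1 - PowerSeries.X ^ 2) * h₁
  fin_cases a
  · exact s₀
  · exact key₁ ▸ ((SummableCoeff.X.mul s₁).mul s₀).add (SummableCoeff.one_sub_X_sq.mul (hG 1))

end Example

/-- Every solution `(v_n)_{n∈ℤ}` of the `Fib_2` recurrence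
`A_n = (1/n!)·[[−1/(n+1), 2^n], [(−1)^n, 0]]` (so `v_n = 0` for all but finitely many
`n < 0` and `v_{n+1} = ∑_{i=0}^∞ A_i v_{n−i}` for `n ≥ 0`, the sum having only finitely
many nonzero terms) is asymptotically periodic with period `2`: for each component
`a : Fin 2` (0-based; the paper's `α = a + 1`) there exist unique complex constants
`(c a).1 = c_1^{(α)}` and `(c a).2 = c_2^{(α)}` with
`v_n^{(α)} − c_1^{(α)} − c_2^{(α)}·(−1)^n → 0`; consequently the subsequences `(v_{2n})`
and `(v_{2n+1})` converge in `ℂ²`, with limits `(c_1^{(α)} + c_2^{(α)})_α` and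
`(c_1^{(α)} − c_2^{(α)})_α` respectively. -/
theorem stmt13 (v : ℤ → Fin 2 → ℂ)
    (hsupp : {n : ℤ | n < 0 ∧ v n ≠ 0}.Finite)
    (hrec : ∀ n : ℕ, v ((n : ℤ) + 1) = ∑' i : ℕ, (exA i).mulVec (v ((n : ℤ) - (i : ℤ)))) :
    (∃! c : Fin 2 → ℂ × ℂ, ∀ a : Fin 2,
      Tendsto (fun n : ℕ => v (n : ℤ) a - (c a).1 - (c a).2 * (-1 : ℂ) ^ n)
        atTop (nhds 0)) ∧
    ∀ c : Fin 2 → ℂ × ℂ,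
      (∀ a : Fin 2,
        Tendsto (fun n : ℕ => v (n : ℤ) a - (c a).1 - (c a).2 * (-1 : ℂ) ^ n)
          atTop (nhds 0)) →
      Tendsto (fun n : ℕ => v ((2 * n : ℕ) : ℤ)) atTop
          (nhds fun a => (c a).1 + (c a).2) ∧
      Tendsto (fun n : ℕ => v ((2 * n + 1 : ℕ) : ℤ)) atTop
          (nhds fun a => (c a).1 - (c a).2) := by
  have hlim : ∀ a : Fin 2, ∃ c : ℂ × ℂ,
      Tendsto (fun n : ℕ => v (n : ℤ) a - c.1 - c.2 * (-1 : ℂ) ^ n) atTop (nhds 0) := fun a =>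
    exists_tendsto_sub_alternating (f := fun n : ℕ => v n a) (by
      simpa only [PowerSeries.coeff_mk] using! (summableCoeff_one_sub_X_sq_mul v hsupp hrec a).summable_sub)
  choose c hc using hlim
  refine ⟨⟨c, hc, fun d hd => funext fun a => ?_⟩, fun d hd => ⟨?_, ?_⟩⟩
  · obtain ⟨c₀, c₁⟩ := (tendsto_sub_alternating_iff (fun n : ℕ => v n a) _ _).1 (hc a)
    obtain ⟨d₀, d₁⟩ := (tendsto_sub_alternating_iff (fun n : ℕ => v n a) _ _).1 (hd a)
    have h₀ := tendsto_nhds_unique d₀ c₀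
    have h₁ := tendsto_nhds_unique d₁ c₁
    ext1
    · linear_combination (h₀ + h₁) / 2
    · linear_combination (h₀ - h₁) / 2
  · exact tendsto_pi_nhds.2 fun a =>
      ((tendsto_sub_alternating_iff (fun n : ℕ => v n a) _ _).1 (hd a)).1
  · exact tendsto_pi_nhds.2 fun a =>
      ((tendsto_sub_alternating_iff (fun n : ℕ => v n a) _ _).1 (hd a)).2
end
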